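/- Let A be a real m×n matrix, b ∈ ℝ^m, B a real s×n matrix, d ∈ ℝ^s, λ > 0, and f(x) = (1/2)‖Ax − b‖² + λ‖x‖₁. If x and x' are both minimizers of f over the set C = {y ∈ ℝⁿ : By = d}, then Ax = Ax'; that is, the value of Ax is invariant over the optimal solution set of the constrained Lasso problem. -/

import Mathlib

open Matrix

/-- Euclidean norm on `Fin n → ℝ`. -/
noncomputable def euclNorm {n : ℕ} (x : Fin n → ℝ) : ℝ := Real.sqrt (∑ i, x i ^ 2)

/-- Euclidean inner product on `Fin n → ℝ`. -/
def dotp {n : ℕ} (x y : Fin n → ℝ) : ℝ := ∑ i, x i * y i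

/-- ℓ₁ norm on `Fin n → ℝ`. -/
def l1norm {n : ℕ} (x : Fin n → ℝ) : ℝ := ∑ i, |x i|

/-- Euclidean distance from a point to a set: `inf_{y ∈ S} ‖x − y‖`. -/
noncomputable def distSet {n : ℕ} (x : Fin n → ℝ) (S : Set (Fin n → ℝ)) : ℝ :=
  sInf ((fun y => euclNorm (x - y)) '' S)

/-- Subdifferential of a (convex) function `g` at `x`. -/
def subdiff {n : ℕ} (g : (Fin n → ℝ) → ℝ) (x : Fin n → ℝ) : Set (Fin n → ℝ) :=
  {s : Fin n → ℝ | ∀ y, g y ≥ g x + dotp s (y - x)}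

theorem euclNorm_sq {n : ℕ} (x : Fin n → ℝ) : euclNorm x ^ 2 = ∑ i, x i ^ 2 :=
  Real.sq_sqrt (Finset.sum_nonneg fun i _ => sq_nonneg (x i))

theorem eq_zero_of_euclNorm_sq_nonpos {n : ℕ} {x : Fin n → ℝ} (h : euclNorm x ^ 2 ≤ 0) :
    x = 0 := by
  rw [euclNorm_sq] at h
  have hnonneg : ∀ i ∈ Finset.univ, 0 ≤ x i ^ 2 := fun i _ => sq_nonneg (x i)
  have hsum := (Finset.sum_eq_zero_iff_of_nonneg hnonneg).1
    (le_antisymm h (Finset.sum_nonneg hnonneg))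
  funext i
  exact pow_eq_zero_iff two_ne_zero |>.1 (hsum i (Finset.mem_univ i))

theorem euclNorm_sq_midpoint {n : ℕ} (u v : Fin n → ℝ) :
    euclNorm ((1 / 2 : ℝ) • (u + v)) ^ 2 =
      (1 / 2) * euclNorm u ^ 2 + (1 / 2) * euclNorm v ^ 2 - (1 / 4) * euclNorm (u - v) ^ 2 := by
  simp only [euclNorm_sq, Finset.mul_sum, ← Finset.sum_add_distrib, ← Finset.sum_sub_distrib,
    Pi.smul_apply, Pi.add_apply, Pi.sub_apply, smul_eq_mul]
  exact Finset.sum_congr rfl fun i _ => by ring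

theorem l1norm_midpoint_le {n : ℕ} (x y : Fin n → ℝ) :
    l1norm ((1 / 2 : ℝ) • (x + y)) ≤ (1 / 2) * l1norm x + (1 / 2) * l1norm y := by
  simp only [l1norm, Finset.mul_sum, ← Finset.sum_add_distrib, Pi.smul_apply, Pi.add_apply,
    smul_eq_mul]
  refine Finset.sum_le_sum fun i _ => ?_
  rw [abs_mul, abs_of_pos (one_half_pos : (0 : ℝ) < 1 / 2), ← mul_add]
  gcongr
  exact abs_add_le _ _

/-- **Invariance of `Ax` over the constrained Lasso solution set** (Lemma 1):
if `x` and `x'` both minimize `f(y) = (1/2)‖Ay−b‖² + λ‖y‖₁` over `{y : By = d}`,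
then `Ax = Ax'`. -/
theorem constrained_lasso_Ax_invariant
    {m n s : ℕ} (A : Matrix (Fin m) (Fin n) ℝ) (b : Fin m → ℝ)
    (B : Matrix (Fin s) (Fin n) ℝ) (d : Fin s → ℝ)
    (lam : ℝ) (hlam : 0 < lam)
    (f : (Fin n → ℝ) → ℝ)
    (hf : f = fun x => (1 / 2) * euclNorm (A *ᵥ x - b) ^ 2 + lam * l1norm x)
    (x x' : Fin n → ℝ)
    (hx : B *ᵥ x = d ∧ ∀ y, B *ᵥ y = d → f x ≤ f y)
    (hx' : B *ᵥ x' = d ∧ ∀ y, B *ᵥ y = d → f x' ≤ f y) :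
    A *ᵥ x = A *ᵥ x' := by
  subst hf
  obtain ⟨hBx, hmin⟩ := hx
  obtain ⟨hBx', hmin'⟩ := hx'
  have hfeas : B *ᵥ ((1 / 2 : ℝ) • (x + x')) = d := by
    rw [mulVec_smul, mulVec_add, hBx, hBx', ← two_smul ℝ d, smul_smul]
    norm_num
  have hle := hmin _ hfeas
  have hle' := hmin' _ hfeas
  have hres : A *ᵥ ((1 / 2 : ℝ) • (x + x')) - b =
      (1 / 2 : ℝ) • ((A *ᵥ x - b) + (A *ᵥ x' - b)) := by
    rw [mulVec_smul, mulVec_add]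
    module
  simp only [hres, euclNorm_sq_midpoint, sub_sub_sub_cancel_right] at hle hle'
  have hl1 := mul_le_mul_of_nonneg_left (l1norm_midpoint_le x x') hlam.le
  exact sub_eq_zero.1 (eq_zero_of_euclNorm_sq_nonpos (by linarith))
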